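/- Let (W,S) and (W',S') be Coxeter systems with finite generating sets S and S', with Coxeter matrices (m_{st}) and (m'_{s't'}) taking values in {2,3,…,∞}. Suppose there is an injective map ι : S → S' such that m_{st} ≤ m'_{ι(s)ι(t)} for all s,t ∈ S, where ∞ is the maximal value of the order (i.e. for s ≠ t either m'_{ι(s)ι(t)} = ∞, or m_{st} is finite and m_{st} ≤ m'_{ι(s)ι(t)}). Then the growth rates satisfy τ_{(W,S)} ≤ τ_{(W',S')}. -/

import Mathlib

open Filter

/-- `a k` is the number of elements of the Coxeter group `W` whose word length
with respect to the simple reflections (indexed by `B`) equals `k`. -/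
noncomputable def coxGrowthSeq {B W : Type*} [Group W] {M : CoxeterMatrix B}
    (cs : CoxeterSystem M W) (k : ℕ) : ℕ :=
  Nat.card {w : W // cs.length w = k}

/-- The growth rate `τ = limsup_k (a k)^(1/k)` of a Coxeter system. -/
noncomputable def coxGrowthRate {B W : Type*} [Group W] {M : CoxeterMatrix B}
    (cs : CoxeterSystem M W) : ℝ :=
  Filter.limsup (fun k : ℕ => (coxGrowthSeq cs k : ℝ) ^ ((1 : ℝ) / k)) Filter.atTop

/-- The growth rate of the canonical Coxeter group attached to the Coxeter matrix `M`. -/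
noncomputable def tau {B : Type*} (M : CoxeterMatrix B) : ℝ :=
  coxGrowthRate M.toCoxeterSystem

namespace CoxeterSystem

variable {B W : Type*} [Group W] {M : CoxeterMatrix B} (cs : CoxeterSystem M W)

/-! ### The exchange condition -/

open scoped Classical in
/-- The action of a simple reflection on pairs of a group element and a sign, whose orbit maps
count occurrences in left inversion sequences modulo two. -/
noncomputable def signedConj (i : B) : Function.End (W × ZMod 2) := fun x ↦
  (cs.simple i * x.1 * cs.simple i, x.2 + if x.1 = cs.simple i then 1 else 0)

open scoped Classical in
theorem signedConj_mul_signedConj_pow (i j : B) (n : ℕ) (x : W × ZMod 2) :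
    ((cs.signedConj i * cs.signedConj j) ^ n) x =
      ((cs.simple i * cs.simple j) ^ n * x.1 * ((cs.simple i * cs.simple j) ^ n)⁻¹,
        x.2 + ∑ k ∈ Finset.range (2 * n),
          if (cs.simple i * cs.simple j) ^ k * x.1 = cs.simple j then 1 else 0) := by
  have swap_pow (k : ℕ) : cs.simple j * (cs.simple i * cs.simple j) ^ k =
      ((cs.simple i * cs.simple j) ^ k)⁻¹ * cs.simple j := by
    have h := map_pow (MulAut.conj (cs.simple j)) (cs.simple i * cs.simple j) k
    simp only [MulAut.conj_apply, inv_simple, mul_assoc, simple_mul_simple_self, mul_one] at h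
    rw [← inv_pow, mul_inv_rev, inv_simple, inv_simple, ← h]
    simp [mul_assoc]
  induction n with
  | zero => ext <;> simp [Function.End.one_def]
  | succ n ih =>
    rw [pow_succ', show ∀ f g : Function.End (W × ZMod 2), (f * g) x = f (g x) from
      fun _ _ ↦ rfl, ih, show ∀ y, (cs.signedConj i * cs.signedConj j) y =
        cs.signedConj i (cs.signedConj j y) from fun _ ↦ rfl]
    have h₁ : (cs.simple i * cs.simple j) ^ n * x.1 * ((cs.simple i * cs.simple j) ^ n)⁻¹ =
        cs.simple j ↔ (cs.simple i * cs.simple j) ^ (2 * n) * x.1 = cs.simple j := by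
      rw [mul_inv_eq_iff_eq_mul, swap_pow, eq_inv_mul_iff_mul_eq, two_mul, pow_add, mul_assoc]
    have h₂ : cs.simple j * ((cs.simple i * cs.simple j) ^ n * x.1 *
        ((cs.simple i * cs.simple j) ^ n)⁻¹) * cs.simple j = cs.simple i ↔
        (cs.simple i * cs.simple j) ^ (2 * n + 1) * x.1 = cs.simple j := by
      have h (y : W) : cs.simple j * y * cs.simple j = cs.simple i ↔
          y = cs.simple j * (cs.simple i * cs.simple j) :=
        ⟨fun h ↦ by simp [← h, mul_assoc], fun h ↦ by simp [h, mul_assoc]⟩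
      rw [h, mul_inv_eq_iff_eq_mul, mul_assoc (cs.simple j), ← pow_succ', swap_pow,
        eq_inv_mul_iff_mul_eq, ← mul_assoc, ← pow_add, show n + 1 + n = 2 * n + 1 by ring]
    simp only [signedConj, h₁, h₂, Nat.mul_succ, Finset.sum_range_succ]
    ext
    · simp [pow_succ', mul_assoc]
    · simp [add_assoc]

theorem isLiftable_signedConj : M.IsLiftable cs.signedConj := by
  classical
  intro i j
  funext x
  rw [signedConj_mul_signedConj_pow, simple_mul_simple_pow, two_mul, Finset.sum_range_add]
  ext
  · simp [Function.End.one_def]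
  · simp [pow_add, CharTwo.add_self_eq_zero, Function.End.one_def]

open scoped Classical in
theorem lift_signedConj_wordProd_inv (ω : List B) (x : W × ZMod 2) :
    cs.lift ⟨_, cs.isLiftable_signedConj⟩ (cs.wordProd ω)⁻¹ x =
      ((cs.wordProd ω)⁻¹ * x.1 * cs.wordProd ω, x.2 + (cs.leftInvSeq ω).count x.1) := by
  induction ω generalizing x with
  | nil => ext <;> simp [Function.End.one_def]
  | cons i ω ih =>
    rw [wordProd_cons, mul_inv_rev, inv_simple, map_mul, lift_apply_simple,
      show ∀ f g : Function.End (W × ZMod 2), (f * g) x = f (g x) from fun _ _ ↦ rfl, ih]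
    have h : (cs.leftInvSeq (i :: ω)).count x.1 =
        (cs.leftInvSeq ω).count (cs.simple i * x.1 * cs.simple i) +
          if x.1 = cs.simple i then 1 else 0 := by
      have hx : x.1 = MulAut.conj (cs.simple i) (cs.simple i * x.1 * cs.simple i) := by
        simp [mul_assoc]
      rw [leftInvSeq, List.count_cons, ← List.count_map_of_injective (cs.leftInvSeq ω) _
        (MulAut.conj (cs.simple i)).injective, ← hx]
      simp only [beq_iff_eq, eq_comm (a := x.1)]
    rw [h]
    ext
    · simp [signedConj, mul_assoc]
    · simp only [signedConj]
      push_cast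
      ring

/-- The exchange condition: a left descent of `π ω` occurs in the left inversion sequence of
`ω`. -/
theorem simple_mem_leftInvSeq_of_isLeftDescent {ω : List B} {i : B}
    (h : cs.IsLeftDescent (cs.wordProd ω) i) : cs.simple i ∈ cs.leftInvSeq ω := by
  classical
  obtain ⟨ω', hω', hprod⟩ := cs.exists_isReduced (cs.simple i * cs.wordProd ω)
  have hω : cs.wordProd ω = cs.wordProd (i :: ω') := by simp [wordProd_cons, ← hprod]
  have hnot : cs.simple i ∉ cs.leftInvSeq ω' := fun hmem ↦ by
    have := (cs.isLeftInversion_of_mem_leftInvSeq hω' hmem).2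
    rw [← hprod, simple_mul_simple_cancel_left] at this
    exact lt_asymm this h
  have key := congrArg Prod.snd
    ((cs.lift_signedConj_wordProd_inv ω (cs.simple i, 0)).symm.trans
      ((congrArg (fun w ↦ cs.lift ⟨_, cs.isLiftable_signedConj⟩ w⁻¹ (cs.simple i, 0)) hω).trans
        (cs.lift_signedConj_wordProd_inv (i :: ω') (cs.simple i, 0))))
  have hcount : ((cs.leftInvSeq ω').map (MulAut.conj (cs.simple i))).count (cs.simple i) = 0 := by
    rw [List.count_eq_zero, List.mem_map]
    rintro ⟨t, ht, hti⟩
    have : t = cs.simple i := (MulAut.conj (cs.simple i)).injective (by simp [hti])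
    exact hnot (this ▸ ht)
  rw [leftInvSeq, List.count_cons, hcount] at key
  by_contra hmem
  rw [List.count_eq_zero.mpr hmem] at key
  simp at key

end CoxeterSystem

/-! ### Orders of products of two simple reflections -/

namespace CoxeterMatrix

variable {B : Type*} (M : CoxeterMatrix B)

/-- The coroot of the geometric representation attached to a simple reflection. -/
noncomputable def coroot (i : B) : Module.Dual ℝ (B →₀ ℝ) :=
  Finsupp.linearCombination ℝ fun j ↦ -2 * Real.cos (Real.pi / M i j)

@[simp]
theorem coroot_single (i j : B) :
    M.coroot i (Finsupp.single j 1) = -2 * Real.cos (Real.pi / M i j) := by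
  simp [coroot]

theorem coroot_single_self (i : B) : M.coroot i (Finsupp.single i 1) = 2 := by
  simp

/-- The image of a simple reflection in the geometric representation. -/
noncomputable def geomReflection (i : B) : (B →₀ ℝ) ≃ₗ[ℝ] (B →₀ ℝ) :=
  Module.reflection (M.coroot_single_self i)

theorem coroot_mul_coroot_sub_two (i j : B) :
    M.coroot i (Finsupp.single j 1) * M.coroot j (Finsupp.single i 1) - 2 =
      2 * Real.cos (2 * Real.pi / M i j) := by
  rw [coroot_single, coroot_single, M.symmetric j i, mul_div_assoc, Real.cos_two_mul]
  ring

theorem sin_two_pi_div_pos {m : ℕ} (hm : 3 ≤ m) : 0 < Real.sin (2 * Real.pi / m) := by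
  have hm' : (3 : ℝ) ≤ m := by exact_mod_cast hm
  apply Real.sin_pos_of_pos_of_lt_pi
  · positivity
  · rw [div_lt_iff₀ (by positivity)]
    nlinarith [Real.pi_pos]

open Polynomial.Chebyshev in
theorem isLiftable_geomReflection : M.IsLiftable M.geomReflection := by
  intro i j
  ext1 z
  obtain h0 | h1 | h2 | h3 : M i j = 0 ∨ M i j = 1 ∨ M i j = 2 ∨ 3 ≤ M i j := by omega
  · simp [h0]
  · obtain rfl : i = j := by
      by_contra hij
      exact M.off_diagonal i j hij h1
    simp [geomReflection, Module.involutive_reflection _ z]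
  all_goals
    rw [geomReflection, geomReflection,
      Module.reflection_mul_reflection_pow_apply _ _ _ _ _ (M.coroot_mul_coroot_sub_two i j).symm]
  · have h2' : M j i = 2 := by rw [M.symmetric, h2]
    simp [h2, h2']
    module
  · have hs := (sin_two_pi_div_pos h3).ne'
    have hS (n : ℤ) := S_two_mul_real_cos (2 * Real.pi / M i j) n
    have hm : (M i j : ℝ) ≠ 0 := by positivity
    obtain ⟨q, hq | hq⟩ := Nat.even_or_odd' (M i j)
    · have h : (S ℝ (q - 1)).eval (2 * Real.cos (2 * Real.pi / M i j)) = 0 := by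
        refine (mul_eq_zero.mp ((hS _).trans ?_)).resolve_right hs
        rw [← Real.sin_pi]
        congr 1
        rw [hq] at hm ⊢
        push_cast at hm ⊢
        have hq' : (q : ℝ) ≠ 0 := right_ne_zero_of_mul hm
        field_simp
        ring
      have e₁ : ((M i j : ℤ) - 2) / 2 = q - 1 := by omega
      have e₂ : ((M i j : ℤ) - 1) / 2 = q - 1 := by omega
      rw [e₁, e₂, h]
      simp
    · have h : (S ℝ q).eval (2 * Real.cos (2 * Real.pi / M i j)) +
          (S ℝ (q - 1)).eval (2 * Real.cos (2 * Real.pi / M i j)) = 0 := by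
        refine (mul_eq_zero.mp ?_).resolve_right hs
        rw [add_mul, hS, hS, ← sub_neg_eq_add, sub_eq_zero, ← Real.sin_sub_two_pi, ← Real.sin_neg]
        congr 1
        rw [hq] at hm ⊢
        push_cast at hm ⊢
        field_simp
        ring
      have e₁ : ((M i j : ℤ) - 2) / 2 = q - 1 := by omega
      have e₂ : ((M i j : ℤ) - 1) / 2 = q := by omega
      have e₃ : ((M i j : ℤ) - 3) / 2 = q - 1 := by omega
      have e₄ : (M i j : ℤ) / 2 = q := by omega
      rw [e₁, e₂, e₃, e₄, h]
      simp

end CoxeterMatrix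

namespace CoxeterSystem

variable {B W : Type*} [Group W] {M : CoxeterMatrix B} (cs : CoxeterSystem M W)

open Polynomial.Chebyshev in
/-- The order of a product of two distinct simple reflections is a multiple of the entry of the
Coxeter matrix. -/
theorem dvd_of_simple_mul_simple_pow_eq_one {i j : B} (hij : i ≠ j) {q : ℕ}
    (h : (cs.simple i * cs.simple j) ^ q = 1) : M i j ∣ q := by
  have key := congrArg (cs.lift ⟨_, M.isLiftable_geomReflection⟩) h
  rw [map_pow, map_mul, lift_apply_simple, lift_apply_simple, map_one] at key
  replace key := LinearEquiv.congr_fun key (Finsupp.single i 1)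
  rw [CoxeterMatrix.geomReflection, CoxeterMatrix.geomReflection,
    Module.reflection_mul_reflection_pow_apply_self _ _ _ _
      (M.coroot_mul_coroot_sub_two i j).symm] at key
  have hi := DFunLike.congr_fun key i
  have hj := DFunLike.congr_fun key j
  simp [hij, hij.symm] at hi hj
  obtain h0 | h1 | h2 | h3 : M i j = 0 ∨ M i j = 1 ∨ M i j = 2 ∨ 3 ≤ M i j := by omega
  · simp only [h0, Nat.cast_zero, div_zero, Real.cos_zero, mul_one, S_eval_two, Int.cast_natCast,
      Int.cast_sub, Int.cast_one, sub_add_cancel] at hi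
    have : (q : ℝ) = 0 := by linarith
    simp [Nat.cast_eq_zero.mp this]
  · exact absurd h1 (M.off_diagonal i j hij)
  · rw [h2]
    refine (Nat.even_or_odd' q).elim fun p hp ↦ hp.elim (fun hp ↦ ⟨p, hp⟩) fun hp ↦ ?_
    simp only [h2, Nat.cast_ofNat, ne_eq, OfNat.ofNat_ne_zero, not_false_eq_true,
      mul_div_cancel_left₀, Real.cos_pi, mul_neg, mul_one, S_eval_neg_two, hp, Nat.cast_add,
      Nat.cast_mul, Nat.cast_one, add_sub_cancel_right, Int.negOnePow_two_mul_add_one,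
      Int.negOnePow_two_mul] at hi
    norm_num at hi
    linarith
  · have hm : (3 : ℝ) ≤ M i j := by exact_mod_cast h3
    have hs := CoxeterMatrix.sin_two_pi_div_pos h3
    have hc : Real.cos (Real.pi / M j i) ≠ 0 := by
      rw [M.symmetric]
      refine (Real.cos_pos_of_mem_Ioo ⟨?_, ?_⟩).ne'
      · exact (neg_neg_of_pos (by positivity)).trans (by positivity)
      · rw [div_lt_div_iff_of_pos_left] <;> first | positivity | linarith
    have hq₀ := hj.resolve_right hc
    rw [hq₀, add_zero] at hi
    have h₀ := S_two_mul_real_cos (2 * Real.pi / M i j) (q - 1)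
    have h₁ := S_two_mul_real_cos (2 * Real.pi / M i j) q
    rw [hq₀, zero_mul] at h₀
    rw [hi, one_mul] at h₁
    push_cast at h₀ h₁
    rw [sub_add_cancel] at h₀
    rw [add_mul, one_mul, Real.sin_add, ← h₀, zero_mul, zero_add] at h₁
    obtain ⟨n, hn⟩ := (Real.cos_eq_one_iff _).mp (mul_right_cancel₀ hs.ne' (h₁.symm.trans
      (one_mul _).symm))
    have hn' : (q : ℝ) = M i j * n := by
      have : (M i j : ℝ) ≠ 0 := by positivity
      have := Real.pi_ne_zero
      field_simp at hn
      linarith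
    exact Int.natCast_dvd_natCast.mp ⟨n, by exact_mod_cast hn'⟩

/-! ### Alternating words -/

/-- The word of length `k` that alternates between `a` and `b` and starts with `a`. -/
def altWord {B : Type*} (a b : B) : ℕ → List B
  | 0 => []
  | k + 1 => a :: altWord b a k

theorem altWord_eq_reverse_alternatingWord {B : Type*} (a b : B) (k : ℕ) :
    altWord a b k = (alternatingWord b a k).reverse := by
  induction k generalizing a b with
  | zero => rfl
  | succ k ih => simp [altWord, alternatingWord_succ, ih]

@[simp]
theorem map_altWord {B B' : Type*} (ι : B → B') (a b : B) (k : ℕ) :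
    (altWord a b k).map ι = altWord (ι a) (ι b) k := by
  induction k generalizing a b with
  | zero => rfl
  | succ k ih => simp [altWord, ih]

@[simp]
theorem length_altWord {B : Type*} (a b : B) (k : ℕ) : (altWord a b k).length = k := by
  simp [altWord_eq_reverse_alternatingWord]

theorem wordProd_altWord_mul_inv (a b : B) (k : ℕ) :
    cs.wordProd (altWord a b k) * (cs.wordProd (altWord b a k))⁻¹ =
      (cs.simple a * cs.simple b) ^ k := by
  induction k generalizing a b with
  | zero => simp [altWord]
  | succ k ih =>
    have h := ih b a
    rw [mul_inv_eq_iff_eq_mul] at h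
    rw [altWord, altWord, wordProd_cons, wordProd_cons, h, pow_succ, ← mul_assoc,
      ← mul_pow_mul]
    simp [mul_assoc]

theorem wordProd_altWord_swap (a b : B) :
    cs.wordProd (altWord a b (M a b)) = cs.wordProd (altWord b a (M a b)) := by
  rw [← mul_inv_eq_one, wordProd_altWord_mul_inv, simple_mul_simple_pow]

theorem IsReduced.le_of_altWord_append {cs : CoxeterSystem M W} {a b : B} {k : ℕ} {x : List B}
    (h : cs.IsReduced (altWord a b k ++ x)) (hM : M a b ≠ 0) : k ≤ M a b := by
  by_contra! hk
  refine cs.not_isReduced_alternatingWord b a (by rwa [M.symmetric]) (m := k)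
    (by rwa [M.symmetric]) ?_
  rw [← isReduced_reverse_iff, ← altWord_eq_reverse_alternatingWord]
  simpa using h.take k

theorem mem_leftInvSeq_altWord_append {t : W} {a b : B} {k : ℕ} {x : List B}
    (ht : t ∈ cs.leftInvSeq (altWord a b k ++ x)) :
    (∃ p < k, t = (cs.simple a * cs.simple b) ^ p * cs.simple a) ∨
      ∃ n < x.length, t * cs.wordProd (altWord a b k ++ x) =
        cs.wordProd (altWord a b k ++ x.eraseIdx n) := by
  induction k generalizing t a b with
  | zero =>
    obtain ⟨n, hn, rfl⟩ := List.mem_iff_getElem.mp ht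
    have h := cs.getD_leftInvSeq_mul_wordProd x n
    rw [length_leftInvSeq] at hn
    refine .inr ⟨n, hn, ?_⟩
    rw [List.getD_eq_getElem _ _ (by simpa using hn)] at h
    exact h
  | succ k ih =>
    rw [altWord, List.cons_append, leftInvSeq, List.mem_cons, List.mem_map] at ht
    obtain rfl | ⟨t, ht, rfl⟩ := ht
    · exact .inl ⟨0, by simp⟩
    obtain ⟨p, hp, rfl⟩ | ⟨n, hn, h⟩ := ih ht
    · refine .inl ⟨p + 1, by omega, ?_⟩
      rw [pow_succ, ← mul_assoc (_ ^ p), mul_pow_mul (cs.simple a)]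
      simp [mul_assoc]
    · refine .inr ⟨n, hn, ?_⟩
      simp [altWord, wordProd_cons, ← h, mul_assoc]

/-- An element with two left descents `ι i` and `ι j` is represented by words starting with long
alternating words in these letters. -/
theorem exists_altWord_append {A : Type*} {ι : A → B} (hι : Function.Injective ι) {i j : A}
    (hij : i ≠ j) {w : W} (hi : cs.IsLeftDescent w (ι i)) (hj : cs.IsLeftDescent w (ι j))
    {x : List A} (hx : cs.wordProd (x.map ι) = w) {k : ℕ}
    (hk : M (ι i) (ι j) = 0 ∨ k ≤ M (ι i) (ι j)) :
    ∃ a b y, (a = i ∧ b = j ∨ a = j ∧ b = i) ∧ k + y.length = x.length ∧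
      cs.wordProd ((altWord a b k ++ y).map ι) = w := by
  induction k with
  | zero => exact ⟨i, j, x, by simp [altWord, hx]⟩
  | succ k ih =>
    obtain ⟨a, b, y, hab, hlen, hw⟩ := ih (hk.imp_right Nat.le_of_succ_le)
    have hb : cs.IsLeftDescent w (ι b) := by rcases hab with ⟨-, rfl⟩ | ⟨-, rfl⟩ <;> assumption
    have hne : a ≠ b := by rcases hab with ⟨rfl, rfl⟩ | ⟨rfl, rfl⟩ <;> simp [hij, hij.symm]
    have hM : M (ι a) (ι b) = M (ι i) (ι j) := by
      rcases hab with ⟨rfl, rfl⟩ | ⟨rfl, rfl⟩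
      exacts [rfl, M.symmetric _ _]
    rw [← hw] at hb
    have hmem := cs.simple_mem_leftInvSeq_of_isLeftDescent hb
    rw [List.map_append, map_altWord] at hmem hw
    obtain ⟨p, hp, h⟩ | ⟨n, hn, h⟩ := cs.mem_leftInvSeq_altWord_append hmem
    · have hpow : (cs.simple (ι a) * cs.simple (ι b)) ^ (p + 1) = 1 := by
        rw [pow_succ, ← mul_assoc, ← h, simple_mul_simple_self]
      have hdvd := cs.dvd_of_simple_mul_simple_pow_eq_one (hι.ne hne) hpow
      rw [hM] at hdvd
      obtain h0 | hk := hk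
      · simp [h0] at hdvd
      · have := Nat.le_of_dvd p.succ_pos hdvd
        omega
    · rw [List.length_map] at hn
      refine ⟨b, a, y.eraseIdx n, by tauto, ?_, ?_⟩
      · rw [List.length_eraseIdx_of_lt hn]
        omega
      · rw [altWord, List.cons_append, List.map_cons, List.map_append, map_altWord, wordProd_cons,
          ← List.eraseIdx_map, ← h, simple_mul_simple_cancel_left, hw]

/-! ### Comparison of Coxeter systems -/

section Comparison

variable {B' W' : Type*} [Group W'] {M' : CoxeterMatrix B'} (cs' : CoxeterSystem M' W')
  {ι : B → B'}

/-- If the entries of `M` are bounded by those of `M'` along `ι`, then `ι` maps reduced words to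
reduced words, and distinct elements of `W` are sent to distinct elements of `W'`. -/
theorem isReduced_map_and_wordProd_eq (hι : Function.Injective ι)
    (h : ∀ s t : B, s ≠ t →
      M'.M (ι s) (ι t) = 0 ∨ (M.M s t ≠ 0 ∧ M.M s t ≤ M'.M (ι s) (ι t))) (n : ℕ) :
    (∀ u : List B, u.length = n → cs.IsReduced u → cs'.IsReduced (u.map ι)) ∧
    ∀ u v : List B, u.length = n → v.length = n → cs.IsReduced u →
      cs'.wordProd (u.map ι) = cs'.wordProd (v.map ι) → cs.wordProd u = cs.wordProd v := by
  induction n with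
  | zero =>
    refine ⟨fun u hu _ ↦ ?_, fun u v hu hv _ _ ↦ ?_⟩
    · simp [List.length_eq_zero_iff.mp hu, IsReduced]
    · rw [List.length_eq_zero_iff.mp hu, List.length_eq_zero_iff.mp hv]
  | succ n ih =>
    obtain ⟨ihred, iheq⟩ := ih
    have red : ∀ u : List B, u.length = n + 1 → cs.IsReduced u → cs'.IsReduced (u.map ι) := by
      rintro (_ | ⟨i, u⟩) hu hred
      · simp at hu
      rw [List.length_cons, Nat.add_right_cancel_iff] at hu
      have hred' : cs.IsReduced u := hred.drop 1
      have hu' := (ihred u hu hred').eq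
      rw [List.length_map] at hu'
      obtain hlt | hdesc := cs'.length_simple_mul (cs'.wordProd (u.map ι)) (ι i)
      · rw [IsReduced, List.map_cons, wordProd_cons, hlt, hu']
        simp
      · exfalso
        have hmem := cs'.simple_mem_leftInvSeq_of_isLeftDescent (cs'.isLeftDescent_iff.mpr hdesc)
        obtain ⟨p, hp, -⟩ | ⟨m, hm, h⟩ :=
          cs'.mem_leftInvSeq_altWord_append (a := ι i) (b := ι i) (k := 0) hmem
        · simp at hp
        simp only [altWord, List.nil_append, List.length_map] at h hm
        have heq := iheq u (i :: u.eraseIdx m) hu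
          (by rw [List.length_cons, List.length_eraseIdx_of_lt hm]; omega) hred'
          (by rw [List.map_cons, wordProd_cons, ← List.eraseIdx_map, ← h,
            simple_mul_simple_cancel_left])
        rw [IsReduced, wordProd_cons, heq, wordProd_cons, simple_mul_simple_cancel_left,
          List.length_cons] at hred
        have hle := cs.length_wordProd_le (u.eraseIdx m)
        rw [List.length_eraseIdx_of_lt hm] at hle
        omega
    have same_head : ∀ (i : B) (u v : List B), (i :: u).length = n + 1 →
        (i :: v).length = n + 1 → cs.IsReduced (i :: u) →
        cs'.wordProd ((i :: u).map ι) = cs'.wordProd ((i :: v).map ι) →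
        cs.wordProd (i :: u) = cs.wordProd (i :: v) := by
      intro i u v hu hv hred heq
      rw [wordProd_cons, wordProd_cons, iheq u v (by simpa using hu) (by simpa using hv)
        (hred.drop 1) (by simpa [wordProd_cons] using heq)]
    refine ⟨red, ?_⟩
    rintro (_ | ⟨i, u⟩) (_ | ⟨j, v⟩) hu hv hred heq
    · rfl
    · simp at hu
    · simp at hv
    obtain rfl | hij := eq_or_ne i j
    · exact same_head i u v hu hv hred heq
    have hlen : cs'.length (cs'.wordProd ((i :: u).map ι)) = n + 1 := by
      rw [(red _ hu hred).eq, List.length_map, hu]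
    have descent (a : B) (x : List B) (hx : (a :: x).length = n + 1)
        (hw : cs'.wordProd ((a :: x).map ι) = cs'.wordProd ((i :: u).map ι)) :
        cs'.IsLeftDescent (cs'.wordProd ((i :: u).map ι)) (ι a) := by
      rw [IsLeftDescent, hlen, ← hw, List.map_cons, wordProd_cons, simple_mul_simple_cancel_left,
        ← hx, List.length_cons, Nat.lt_succ_iff]
      simpa using cs'.length_wordProd_le (x.map ι)
    have hi := descent i u hu rfl
    have hj := descent j v hv heq.symm
    obtain ⟨m, hm⟩ : ∃ m, m = M' (ι i) (ι j) := ⟨_, rfl⟩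
    have hm0 : m ≠ 0 := by
      rintro rfl
      obtain ⟨a, b, y, -, hy, -⟩ := cs'.exists_altWord_append hι hij hi hj rfl
        (k := n + 2) (.inl hm.symm)
      omega
    have hbraid (y : List B) : cs'.wordProd ((altWord i j m ++ y).map ι) =
        cs'.wordProd ((altWord j i m ++ y).map ι) := by
      rw [List.map_append, List.map_append, map_altWord, map_altWord, wordProd_append,
        wordProd_append, hm, wordProd_altWord_swap]
    obtain ⟨y, hy, hwi, hwj⟩ : ∃ y : List B, m + y.length = n + 1 ∧
        cs'.wordProd ((i :: u).map ι) = cs'.wordProd ((altWord i j m ++ y).map ι) ∧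
        cs'.wordProd ((altWord j i m ++ y).map ι) = cs'.wordProd ((j :: v).map ι) := by
      obtain ⟨a, b, y, ⟨rfl, rfl⟩ | ⟨rfl, rfl⟩, hy, hw⟩ :=
        cs'.exists_altWord_append hι hij hi hj rfl (.inr hm.le)
      · exact ⟨y, hy.trans hu, hw.symm, by rw [← hbraid, hw, heq]⟩
      · exact ⟨y, hy.trans hu, by rw [hbraid, hw], by rw [hw, heq]⟩
    have hlen' (a b : B) : (altWord a b m ++ y).length = n + 1 := by simp [hy]
    obtain ⟨k, rfl⟩ := Nat.exists_eq_succ_of_ne_zero hm0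
    have hπi : cs.wordProd (i :: u) = cs.wordProd (altWord i j (k + 1) ++ y) :=
      same_head _ _ _ hu (hlen' i j) hred hwi
    have hredi : cs.IsReduced (altWord i j (k + 1) ++ y) := by
      rw [IsReduced, ← hπi, hred.eq, hu, hlen']
    have hMM : k + 1 = M i j := by
      obtain h0 | ⟨h0, hle⟩ := h i j hij
      · exact absurd (hm.trans h0) hm0
      · exact (hredi.le_of_altWord_append h0).antisymm (hle.trans hm.ge)
    have hswap : cs.wordProd (altWord i j (k + 1) ++ y) =
        cs.wordProd (altWord j i (k + 1) ++ y) := by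
      rw [wordProd_append, wordProd_append, hMM, wordProd_altWord_swap]
    have hredj : cs.IsReduced (altWord j i (k + 1) ++ y) := by
      rw [IsReduced, ← hswap, hredi.eq, hlen', hlen']
    rw [hπi, hswap]
    exact same_head _ _ _ (hlen' j i) hv hredj hwj

theorem exists_injective_vector (k : ℕ) :
    ∃ f : {w : W // cs.length w = k} → List.Vector B k, Function.Injective f := by
  have hword (w : {w : W // cs.length w = k}) : ∃ ω : List.Vector B k, cs.wordProd ω.1 = w := by
    obtain ⟨ω, hred, hw⟩ := cs.exists_isReduced w.1
    exact ⟨⟨ω, by rw [← hred.eq, ← hw, w.2]⟩, hw.symm⟩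
  choose ω hω using hword
  exact ⟨ω, fun w₁ w₂ hw ↦ Subtype.ext (by rw [← hω, ← hω, hw])⟩

theorem coxGrowthSeq_le_card_pow [Fintype B] (k : ℕ) :
    coxGrowthSeq cs k ≤ Fintype.card B ^ k := by
  rw [← card_vector, ← Nat.card_eq_fintype_card]
  obtain ⟨f, hf⟩ := cs.exists_injective_vector k
  exact Nat.card_le_card_of_injective f hf

theorem coxGrowthSeq_mono [Finite B'] (hι : Function.Injective ι)
    (h : ∀ s t : B, s ≠ t →
      M'.M (ι s) (ι t) = 0 ∨ (M.M s t ≠ 0 ∧ M.M s t ≤ M'.M (ι s) (ι t))) (k : ℕ) :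
    coxGrowthSeq cs k ≤ coxGrowthSeq cs' k := by
  obtain ⟨f, hf⟩ := cs'.exists_injective_vector k
  have := Fintype.ofFinite B'
  have := Finite.of_injective f hf
  have hword (w : {w : W // cs.length w = k}) :
      ∃ ω : List B, ω.length = k ∧ cs.IsReduced ω ∧ cs.wordProd ω = w := by
    obtain ⟨ω, hred, hw⟩ := cs.exists_isReduced w.1
    exact ⟨ω, by rw [← hred.eq, ← hw, w.2], hred, hw.symm⟩
  choose ω hlen hred hprod using hword
  obtain ⟨red, eq⟩ := cs.isReduced_map_and_wordProd_eq cs' hι h k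
  refine Nat.card_le_card_of_injective
    (fun w ↦ ⟨cs'.wordProd ((ω w).map ι), ?_⟩) fun w₁ w₂ hw ↦ ?_
  · rw [(red _ (hlen w) (hred w)).eq, List.length_map, hlen]
  · rw [Subtype.ext_iff, ← hprod, ← hprod]
    exact eq _ _ (hlen _) (hlen _) (hred _) (Subtype.ext_iff.mp hw)

end Comparison

end CoxeterSystem

theorem growthRate_monotone {B B' W W' : Type*} [Group W] [Group W']
    [Fintype B] [Fintype B']
    {M : CoxeterMatrix B} {M' : CoxeterMatrix B'}
    (cs : CoxeterSystem M W) (cs' : CoxeterSystem M' W')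
    (ι : B → B') (hι : Function.Injective ι)
    (h : ∀ s t : B, s ≠ t →
      M'.M (ι s) (ι t) = 0 ∨ (M.M s t ≠ 0 ∧ M.M s t ≤ M'.M (ι s) (ι t))) :
    coxGrowthRate cs ≤ coxGrowthRate cs' := by
  have bound : ∀ᶠ k : ℕ in atTop,
      (coxGrowthSeq cs' k : ℝ) ^ ((1 : ℝ) / k) ≤ Fintype.card B' := by
    filter_upwards [eventually_ge_atTop 1] with k hk
    calc (coxGrowthSeq cs' k : ℝ) ^ ((1 : ℝ) / k)
        ≤ ((Fintype.card B' : ℝ) ^ k) ^ ((1 : ℝ) / k) := by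
          gcongr
          exact_mod_cast cs'.coxGrowthSeq_le_card_pow k
      _ = Fintype.card B' := by
          rw [one_div, Real.pow_rpow_inv_natCast (by positivity) (by omega)]
  refine limsup_le_limsup (.of_forall fun k ↦ ?_) ?_ ?_
  · dsimp only
    gcongr
    exact cs.coxGrowthSeq_mono cs' hι h k
  · exact isCoboundedUnder_le_of_le _ (x := 0) fun k ↦
      Real.rpow_nonneg (Nat.cast_nonneg _) _
  · exact ⟨_, bound⟩
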